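/- Let λ_2 be the greatest real root of the polynomial X³ − 2X² − 2X + 2 (one has λ_2 = 2.48119…). Then S_F^{(2)}(N) ≍ N^{(log λ_2)/(log φ)} as N → ∞. -/

import Mathlib

/-- The Fibonacci sequence with `f 1 = 1`, `f 2 = 2`, `f (n+2) = f (n+1) + f n`
(the value at `0` is a dummy). -/
def fibS : ℕ → ℕ
  | 0 => 0
  | 1 => 1
  | 2 => 2
  | n + 3 => fibS (n + 2) + fibS (n + 1)

/-- `rF n` is the number of ways to write `n` as a sum of distinct Fibonacci numbers,
i.e. the number of finite sets `S` of positive integers with `∑ i ∈ S, fibS i = n`. -/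
noncomputable def rF (n : ℕ) : ℕ :=
  Nat.card {S : Finset ℕ // 0 ∉ S ∧ ∑ i ∈ S, fibS i = n}

/-- The power sum `S_F^{(p)}(N) = ∑_{n=0}^{N-1} (rF n)^p`. -/
noncomputable def SF (p N : ℕ) : ℕ :=
  ∑ n ∈ Finset.range N, (rF n) ^ p

/-- The golden ratio. -/
noncomputable def phi : ℝ := (1 + Real.sqrt 5) / 2

open Finset

lemma fibS_add_two (k : ℕ) : fibS (k + 3) = fibS (k + 2) + fibS (k + 1) := rfl

lemma le_fibS (k : ℕ) : k ≤ fibS k := by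
  induction k using Nat.strong_induction_on with
  | _ k ih =>
    match k with
    | 0 => simp [fibS]
    | 1 => simp [fibS]
    | 2 => simp [fibS]
    | k + 3 =>
      have h1 := ih (k + 2) (by omega)
      have h2 := ih (k + 1) (by omega)
      rw [fibS_add_two]
      omega

lemma fibS_strictMono : StrictMono fibS := by
  refine strictMono_nat_of_lt_succ fun k ↦ ?_
  match k with
  | 0 => simp [fibS]
  | 1 => simp [fibS]
  | k + 2 =>
    have := le_fibS (k + 1)
    rw [fibS_add_two]
    omega

lemma Icc_one_succ (k : ℕ) : Icc 1 (k + 1) = insert (k + 1) (Icc 1 k) := by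
  ext i
  simp only [mem_Icc, mem_insert]
  omega

lemma sum_powerset_Icc_succ {M : Type*} [AddCommMonoid M] (k : ℕ) (g : ℕ → M) :
    ∑ S ∈ (Icc 1 (k + 1)).powerset, g (∑ i ∈ S, fibS i) =
      ∑ S ∈ (Icc 1 k).powerset, g (∑ i ∈ S, fibS i) +
        ∑ S ∈ (Icc 1 k).powerset, g (fibS (k + 1) + ∑ i ∈ S, fibS i) := by
  have hk : k + 1 ∉ Icc 1 k := by simp
  rw [Icc_one_succ, sum_powerset_insert hk]
  congr 1
  refine sum_congr rfl fun S hS ↦ ?_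
  rw [sum_insert fun h ↦ hk (mem_powerset.1 hS h)]

lemma sum_Icc_fibS (k : ℕ) : ∑ i ∈ Icc 1 k, fibS i + 2 = fibS (k + 2) := by
  induction k with
  | zero => simp [fibS]
  | succ k ih =>
    rw [Icc_one_succ, sum_insert (by simp), fibS_add_two]
    omega

lemma sum_fibS_lt {k : ℕ} {S : Finset ℕ} (hS : S ∈ (Icc 1 k).powerset) :
    ∑ i ∈ S, fibS i < fibS (k + 2) := by
  have h := sum_le_sum_of_subset (f := fibS) (mem_powerset.1 hS)
  have := sum_Icc_fibS k
  omega

/-- The number of pairs of subsets of `{1, …, k}` whose Fibonacci sums differ by `d`. -/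
def diffCount (k : ℕ) (d : ℤ) : ℕ :=
  ∑ S ∈ (Icc 1 k).powerset, ∑ T ∈ (Icc 1 k).powerset,
    if ((∑ i ∈ S, fibS i : ℕ) : ℤ) - (∑ i ∈ T, fibS i : ℕ) = d then 1 else 0

lemma diffCount_neg (k : ℕ) (d : ℤ) : diffCount k (-d) = diffCount k d := by
  unfold diffCount
  rw [sum_comm]
  refine sum_congr rfl fun S _ ↦ sum_congr rfl fun T _ ↦ ?_
  congr 1
  apply propext
  omega

lemma diffCount_succ (k : ℕ) (d : ℤ) :
    diffCount (k + 1) d =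
      2 * diffCount k d + diffCount k (d - fibS (k + 1)) + diffCount k (d + fibS (k + 1)) := by
  unfold diffCount
  rw [sum_powerset_Icc_succ k fun s ↦ ∑ T ∈ (Icc 1 (k + 1)).powerset,
    if (s : ℤ) - (∑ i ∈ T, fibS i : ℕ) = d then 1 else 0]
  simp_rw [fun s : ℕ ↦ sum_powerset_Icc_succ k fun t ↦ if (s : ℤ) - (t : ℕ) = d then 1 else 0]
  simp only [two_mul, ← sum_add_distrib]
  refine sum_congr rfl fun S _ ↦ sum_congr rfl fun T _ ↦ ?_
  generalize ∑ i ∈ S, fibS i = s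
  generalize ∑ i ∈ T, fibS i = t
  push_cast
  have e1 : ((fibS (k + 1) : ℤ) + s - (fibS (k + 1) + t) = d) ↔ ((s : ℤ) - t = d) := by omega
  have e2 : ((s : ℤ) - (fibS (k + 1) + t) = d) ↔ ((s : ℤ) - t = d + fibS (k + 1)) := by omega
  have e3 : ((fibS (k + 1) : ℤ) + s - t = d) ↔ ((s : ℤ) - t = d - fibS (k + 1)) := by omega
  simp only [e1, e2, e3]
  ring

lemma diffCount_eq_zero {k : ℕ} {d : ℤ} (hd : (fibS (k + 2) : ℤ) ≤ d) : diffCount k d = 0 := by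
  refine sum_eq_zero fun S hS ↦ sum_eq_zero fun T _ ↦ if_neg ?_
  have := sum_fibS_lt hS
  omega

lemma diffCount_succ_zero (k : ℕ) :
    diffCount (k + 1) 0 = 2 * diffCount k 0 + 2 * diffCount k (fibS (k + 1)) := by
  rw [diffCount_succ, zero_sub, diffCount_neg, zero_add]
  ring

lemma diffCount_add_two_fibS (k : ℕ) :
    diffCount (k + 2) (fibS (k + 3)) = 2 * diffCount k (fibS (k + 1)) + diffCount k 0 := by
  have h1 : (fibS (k + 3) : ℤ) = fibS (k + 2) + fibS (k + 1) := by
    exact_mod_cast fibS_add_two k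
  have hm : (fibS (k + 1) : ℤ) < fibS (k + 2) := by
    exact_mod_cast fibS_strictMono (Nat.lt_succ_self _)
  rw [diffCount_succ (k + 1), diffCount_eq_zero (k := k + 1) (d := fibS (k + 3)) le_rfl,
    diffCount_eq_zero (k := k + 1) (d := fibS (k + 3) + fibS (k + 1 + 1)) (by simp),
    show (fibS (k + 3) : ℤ) - fibS (k + 1 + 1) = fibS (k + 1) by rw [h1]; ring,
    diffCount_succ, sub_self, diffCount_eq_zero (k := k) (d := fibS (k + 1) + fibS (k + 1))]
  · ring
  · cases k with
    | zero => simp [fibS]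
    | succ k =>
      have hm : (fibS (k + 1) : ℤ) < fibS (k + 2) := by
        exact_mod_cast fibS_strictMono (Nat.lt_succ_self _)
      rw [fibS_add_two]
      push_cast
      linarith

/-- The number of representations of `n` as a sum of distinct members of `fibS 1, …, fibS k`. -/
def reprCount (k n : ℕ) : ℕ :=
  ∑ S ∈ (Icc 1 k).powerset, if ∑ i ∈ S, fibS i = n then 1 else 0

lemma rF_eq_reprCount {k n : ℕ} (hn : n < fibS (k + 1)) : rF n = reprCount k n := by
  rw [reprCount, ← card_filter, rF, ← Nat.card_eq_finsetCard]
  refine Nat.card_congr (Equiv.subtypeEquivRight fun S ↦ ?_)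
  rw [mem_filter, mem_powerset]
  refine and_congr_left fun hS ↦ ⟨fun h0 i hi ↦ ?_, fun h h0 ↦ ?_⟩
  · have h1 : fibS i ≤ n := hS ▸ single_le_sum (f := fibS) (fun _ _ ↦ Nat.zero_le _) hi
    have h2 := fibS_strictMono.lt_iff_lt.1 (h1.trans_lt hn)
    have h3 : i ≠ 0 := by
      rintro rfl
      exact h0 hi
    rw [mem_Icc]
    omega
  · simpa using h h0

lemma reprCount_mono (n : ℕ) : Monotone fun k ↦ reprCount k n := by
  intro k l hkl
  exact sum_le_sum_of_subset (powerset_mono.2 (Icc_subset_Icc_right hkl))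

lemma reprCount_le_rF (k n : ℕ) : reprCount k n ≤ rF n := by
  have h : n < fibS (max k n + 1) :=
    lt_of_lt_of_le (by omega) (le_fibS (max k n + 1))
  rw [rF_eq_reprCount h]
  exact reprCount_mono n (le_max_left k n)

lemma sum_reprCount_sq (k N : ℕ) :
    ∑ n ∈ range N, reprCount k n ^ 2 =
      ∑ S ∈ (Icc 1 k).powerset, ∑ T ∈ (Icc 1 k).powerset,
        if ∑ i ∈ S, fibS i = ∑ i ∈ T, fibS i ∧ ∑ i ∈ S, fibS i < N then 1 else 0 := by
  simp_rw [reprCount, sq, sum_mul_sum]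
  rw [sum_comm]
  refine sum_congr rfl fun S _ ↦ ?_
  rw [sum_comm]
  refine sum_congr rfl fun T _ ↦ ?_
  generalize ∑ i ∈ S, fibS i = s
  generalize ∑ i ∈ T, fibS i = t
  by_cases hst : s = t
  · subst hst
    simp
  · rw [if_neg (by tauto)]
    refine sum_eq_zero fun n _ ↦ ?_
    by_cases hs : s = n
    · have : t ≠ n := by omega
      simp [this]
    · simp [hs]

lemma SF_two_le (k : ℕ) : SF 2 (fibS (k + 1)) ≤ diffCount k 0 := by
  have h : SF 2 (fibS (k + 1)) = ∑ n ∈ range (fibS (k + 1)), reprCount k n ^ 2 :=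
    sum_congr rfl fun n hn ↦ by rw [rF_eq_reprCount (mem_range.1 hn)]
  rw [h, sum_reprCount_sq]
  refine sum_le_sum fun S _ ↦ sum_le_sum fun T _ ↦ ?_
  split_ifs <;> omega

lemma diffCount_zero_le_SF (k : ℕ) : diffCount k 0 ≤ SF 2 (fibS (k + 2)) := by
  have h : ∑ n ∈ range (fibS (k + 2)), reprCount k n ^ 2 ≤ SF 2 (fibS (k + 2)) :=
    sum_le_sum fun n _ ↦ Nat.pow_le_pow_left (reprCount_le_rF k n) 2
  refine le_trans ?_ h
  rw [sum_reprCount_sq]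
  refine sum_le_sum fun S hS ↦ sum_le_sum fun T _ ↦ ?_
  have := sum_fibS_lt hS
  split_ifs <;> omega

lemma SF_mono (p : ℕ) : Monotone (SF p) := fun _ _ h ↦
  sum_le_sum_of_subset (range_subset_range.2 h)

lemma diffCount_zero_zero : diffCount 0 0 = 1 := by
  rw [diffCount, Icc_eq_empty (by simp), powerset_empty, sum_singleton, sum_singleton]
  simp

lemma diffCount_zero_one : diffCount 0 1 = 0 := by simp [diffCount]

lemma diffCount_one_two : diffCount 1 2 = 0 := by
  rw [diffCount_succ, diffCount_eq_zero (k := 0) (d := 2) (by simp [fibS]),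
    diffCount_eq_zero (k := 0) (d := 2 + fibS (0 + 1)) (by simp [fibS])]
  simpa [fibS] using diffCount_zero_one

lemma diffCount_two_three : diffCount 2 3 = 1 := by
  have := diffCount_add_two_fibS 0
  simpa [fibS, diffCount_zero_zero, diffCount_zero_one] using this

lemma diffCount_one_zero : diffCount 1 0 = 2 := by
  have := diffCount_succ_zero 0
  simpa [fibS, diffCount_zero_zero, diffCount_zero_one] using this

lemma diffCount_two_zero : diffCount 2 0 = 4 := by
  have := diffCount_succ_zero 1
  simpa [fibS, diffCount_one_zero, diffCount_one_two] using this

lemma diffCount_three_five : diffCount 3 5 = 2 := by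
  have := diffCount_add_two_fibS 1
  simpa [fibS, diffCount_one_zero, diffCount_one_two] using this

/-- The vector `(2, lam - 2, lam * (lam - 2))` is an eigenvector of the linear recursion on
`(a k, b k, b (k + 1))`, so a bound by a multiple of it propagates. -/
lemma le_of_recursion {lam : ℝ} (hroot : lam ^ 3 - 2 * lam ^ 2 - 2 * lam + 2 = 0) {a b : ℕ → ℝ}
    (ha : ∀ k, a (k + 1) = 2 * a k + 2 * b k) (hb : ∀ k, b (k + 2) = 2 * b k + a k) {C : ℝ}
    (h0 : a 0 ≤ C * 2) (h1 : b 0 ≤ C * (lam - 2)) (h2 : b 1 ≤ C * (lam * (lam - 2))) (k : ℕ) :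
    a k ≤ C * lam ^ k * 2 := by
  suffices h : a k ≤ C * lam ^ k * 2 ∧ b k ≤ C * lam ^ k * (lam - 2) ∧
      b (k + 1) ≤ C * lam ^ k * (lam * (lam - 2)) from h.1
  induction k with
  | zero => simpa using ⟨h0, h1, h2⟩
  | succ k ih =>
    obtain ⟨h0, h1, h2⟩ := ih
    rw [ha, hb]
    refine ⟨?_, ?_, ?_⟩
    · rw [pow_succ]
      linarith
    · rw [pow_succ]
      linarith
    · have h : C * lam ^ (k + 1) * (lam * (lam - 2)) =
          2 * (C * lam ^ k * (lam - 2)) + C * lam ^ k * 2 := by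
        linear_combination C * lam ^ k * hroot
      linarith

lemma diffCount_zero_le {lam : ℝ} (hroot : lam ^ 3 - 2 * lam ^ 2 - 2 * lam + 2 = 0)
    (hlam : 2 < lam) (k : ℕ) : (diffCount k 0 : ℝ) ≤ 2 * lam ^ k := by
  have h := le_of_recursion hroot (C := 1) (a := fun k ↦ (diffCount k 0 : ℝ))
    (b := fun k ↦ (diffCount k (fibS (k + 1)) : ℝ))
    (fun k ↦ by exact_mod_cast diffCount_succ_zero k)
    (fun k ↦ by exact_mod_cast diffCount_add_two_fibS k)
    (by simp [diffCount_zero_zero])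
    (by simp [fibS, diffCount_zero_one, hlam.le])
    (by
      simp only [fibS, Nat.cast_ofNat, diffCount_one_two, Nat.cast_zero]
      nlinarith) k
  linarith

lemma le_diffCount_zero {lam : ℝ} (hroot : lam ^ 3 - 2 * lam ^ 2 - 2 * lam + 2 = 0)
    (hlam : 2 < lam) (k : ℕ) : 2 * lam ^ k ≤ lam ^ 2 * diffCount (k + 2) 0 := by
  have h := le_of_recursion hroot (C := -1) (a := fun k ↦ -(lam ^ 2 * diffCount (k + 2) 0))
    (b := fun k ↦ -(lam ^ 2 * diffCount (k + 2) (fibS (k + 3))))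
    (fun k ↦ by
      have : (diffCount (k + 3) 0 : ℝ) =
          2 * diffCount (k + 2) 0 + 2 * diffCount (k + 2) (fibS (k + 3)) := by
        exact_mod_cast diffCount_succ_zero (k + 2)
      linear_combination -lam ^ 2 * this)
    (fun k ↦ by
      have : (diffCount (k + 4) (fibS (k + 5)) : ℝ) =
          2 * diffCount (k + 2) (fibS (k + 3)) + diffCount (k + 2) 0 := by
        exact_mod_cast diffCount_add_two_fibS (k + 2)
      linear_combination -lam ^ 2 * this)
    (by
      simp only [zero_add, diffCount_two_zero]
      push_cast
      nlinarith)
    (by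
      simp only [zero_add, fibS, Nat.reduceAdd, Nat.cast_ofNat, diffCount_two_three]
      push_cast
      nlinarith)
    (by
      simp only [fibS, Nat.reduceAdd, Nat.cast_ofNat, diffCount_three_five]
      nlinarith) k
  linarith

lemma two_lt_of_greatest_root {lam : ℝ}
    (hgreatest : ∀ x : ℝ, x ^ 3 - 2 * x ^ 2 - 2 * x + 2 = 0 → x ≤ lam) : 2 < lam := by
  have hc : ContinuousOn (fun x : ℝ ↦ x ^ 3 - 2 * x ^ 2 - 2 * x + 2) (Set.Icc 2 3) := by fun_prop
  obtain ⟨x, hx, hx0⟩ := intermediate_value_Ioo (by norm_num) hc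
    (show (0 : ℝ) ∈ Set.Ioo _ _ by constructor <;> norm_num)
  exact hx.1.trans_le (hgreatest x hx0)

lemma phi_sq : phi ^ 2 = phi + 1 := Real.goldenRatio_sq

lemma one_lt_phi : 1 < phi := Real.one_lt_goldenRatio

lemma phi_lt_two : phi < 2 := Real.goldenRatio_lt_two

lemma fibS_bounds (k : ℕ) :
    phi ^ k ≤ (fibS (k + 1) : ℝ) ∧ (fibS (k + 1) : ℝ) ≤ phi ^ (k + 1) := by
  have hs := phi_sq
  have h1 := one_lt_phi
  have h2 := phi_lt_two
  induction k using Nat.strong_induction_on with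
  | _ k ih =>
    match k with
    | 0 => simpa [fibS] using h1.le
    | 1 =>
      simp only [fibS, Nat.cast_ofNat, pow_one, Nat.reduceAdd]
      constructor <;> linarith
    | k + 2 =>
      obtain ⟨l1, u1⟩ := ih (k + 1) (by omega)
      obtain ⟨l2, u2⟩ := ih k (by omega)
      rw [fibS_add_two]
      push_cast
      constructor
      · calc phi ^ (k + 2) = phi ^ (k + 1) + phi ^ k := by linear_combination phi ^ k * hs
          _ ≤ _ := add_le_add l1 l2
      · calc _ ≤ phi ^ (k + 2) + phi ^ (k + 1) := add_le_add u1 u2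
          _ = phi ^ (k + 2 + 1) := by linear_combination -phi ^ (k + 1) * hs

lemma phi_pow_rpow {lam : ℝ} (hlam : 0 < lam) (k : ℕ) :
    (phi ^ k) ^ (Real.log lam / Real.log phi) = lam ^ k := by
  have hphi : 0 < phi := zero_lt_one.trans one_lt_phi
  have hlog : Real.log phi ≠ 0 := (Real.log_pos one_lt_phi).ne'
  rw [← Real.rpow_natCast phi, ← Real.rpow_mul hphi.le, mul_comm, Real.rpow_mul hphi.le,
    Real.rpow_natCast, Real.rpow_def_of_pos hphi, mul_div_cancel₀ _ hlog, Real.exp_log hlam]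

lemma exists_fibS_le_lt {N : ℕ} (hN : 5 ≤ N) : ∃ j, fibS (j + 4) ≤ N ∧ N < fibS (j + 5) := by
  have hex : ∃ j, N < fibS (j + 5) := ⟨N, lt_of_lt_of_le (by omega) (le_fibS (N + 5))⟩
  refine ⟨Nat.find hex, ?_, Nat.find_spec hex⟩
  rcases h : Nat.find hex with _ | j
  · simpa [fibS] using hN
  · exact not_lt.1 (Nat.find_min hex (m := j) (by omega))

theorem SF_two_asymp (lam : ℝ)
    (hroot : lam ^ 3 - 2 * lam ^ 2 - 2 * lam + 2 = 0)
    (hgreatest : ∀ x : ℝ, x ^ 3 - 2 * x ^ 2 - 2 * x + 2 = 0 → x ≤ lam) :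
    ∃ c C : ℝ, 0 < c ∧ c ≤ C ∧ ∃ N₀ : ℕ, ∀ N : ℕ, N₀ ≤ N →
      c * (N : ℝ) ^ (Real.log lam / Real.log phi) ≤ (SF 2 N : ℝ) ∧
      (SF 2 N : ℝ) ≤ C * (N : ℝ) ^ (Real.log lam / Real.log phi) := by
  have hlam := two_lt_of_greatest_root hgreatest
  have hlam0 : 0 < lam := by linarith
  have hexp : 0 ≤ Real.log lam / Real.log phi :=
    div_nonneg (Real.log_nonneg (by linarith)) (Real.log_pos one_lt_phi).le
  have hphi : 0 < phi := zero_lt_one.trans one_lt_phi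
  have h5 : 1 ≤ lam ^ 7 := one_le_pow₀ (by linarith)
  refine ⟨2 / lam ^ 7, 2 * lam, by positivity, ?_, 5, fun N hN ↦ ?_⟩
  · rw [div_le_iff₀ (by positivity)]
    nlinarith
  obtain ⟨j, hj, hj'⟩ := exists_fibS_le_lt hN
  have hlow : phi ^ (j + 3) ≤ N := (fibS_bounds (j + 3)).1.trans (by exact_mod_cast hj)
  have hupp : (N : ℝ) ≤ phi ^ (j + 5) :=
    le_trans (by exact_mod_cast hj'.le) (fibS_bounds (j + 4)).2
  have hlow' := Real.rpow_le_rpow (by positivity) hlow hexp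
  have hupp' := Real.rpow_le_rpow (by positivity) hupp hexp
  rw [phi_pow_rpow hlam0] at hlow' hupp'
  have hSlow : (diffCount (j + 2) 0 : ℝ) ≤ SF 2 N := by
    exact_mod_cast (diffCount_zero_le_SF (j + 2)).trans (SF_mono 2 hj)
  have hSupp : (SF 2 N : ℝ) ≤ diffCount (j + 4) 0 := by
    exact_mod_cast (SF_mono 2 hj'.le).trans (SF_two_le (j + 4))
  constructor
  · calc 2 / lam ^ 7 * (N : ℝ) ^ (Real.log lam / Real.log phi)
        ≤ 2 / lam ^ 7 * lam ^ (j + 5) := by gcongr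
      _ = 2 * lam ^ j / lam ^ 2 := by
        field_simp
        ring
      _ ≤ diffCount (j + 2) 0 := by
        rw [div_le_iff₀' (by positivity)]
        exact le_diffCount_zero hroot hlam j
      _ ≤ SF 2 N := hSlow
  · calc (SF 2 N : ℝ) ≤ 2 * lam ^ (j + 4) := hSupp.trans (diffCount_zero_le hroot hlam (j + 4))
      _ = 2 * lam * lam ^ (j + 3) := by ring
      _ ≤ 2 * lam * (N : ℝ) ^ (Real.log lam / Real.log phi) := by gcongr
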